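/- arXiv:2004.08093 — 2 statements merged into one kernel-verified Lean document; each statement's English description precedes it below -/
import Mathlib

section
/- Let a >= 1 and k >= 2 be integers. If k is congruent to 3 modulo 4, or k + 2a is congruent to 0 modulo 4, then the starlike tree T(a, a+1, ..., a+k) with arms of lengths a, a+1, ..., a+k is transmission irregular. -/
/-- The transmission of a vertex `v`: the sum of distances from `v` to all vertices. -/
noncomputable def transmission {V : Type*} [Fintype V] (G : SimpleGraph V) (v : V) : ℕ :=
  ∑ u, G.dist v u

/-- A graph is transmission irregular if all vertices have pairwise distinct transmissions. -/
def TransmissionIrregular {V : Type*} [Fintype V] (G : SimpleGraph V) : Prop :=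
  Function.Injective (transmission G)

/-- The starlike tree `T(k 0, …, k (t-1))`: a central vertex (`none`) with `t` pendant
paths attached, the `i`-th of length `k i`; `some ⟨i, j⟩` is the vertex at distance
`j + 1` from the center on the `i`-th arm. -/
def starlike (t : ℕ) (k : Fin t → ℕ) :
    SimpleGraph (Option (Σ i : Fin t, Fin (k i))) :=
  SimpleGraph.fromRel (fun x y =>
    (∃ i : Fin t, ∃ j : Fin (k i), x = none ∧ y = some ⟨i, j⟩ ∧ (j : ℕ) = 0) ∨
    (∃ i : Fin t, ∃ j j' : Fin (k i), x = some ⟨i, j⟩ ∧ y = some ⟨i, j'⟩ ∧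
      (j' : ℕ) = (j : ℕ) + 1))

namespace SimpleGraph

variable {V : Type*} {G : SimpleGraph V}

/-- A function which vanishes at `v`, is 1-Lipschitz along edges and strictly decreases along some
edge away from `v` is the distance from `v`. -/
theorem dist_eq_of_lipschitz_of_descent (v : V) (f : V → ℕ) (hv : f v = 0)
    (hlip : ∀ x y, G.Adj x y → f y ≤ f x + 1)
    (hdesc : ∀ u, u ≠ v → ∃ w, G.Adj w u ∧ f u = f w + 1) (u : V) : G.dist v u = f u := by
  have hwalk : ∀ n u, f u = n → ∃ p : G.Walk v u, p.length = n := by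
    intro n
    induction n with
    | zero =>
      intro u hu
      by_cases h : u = v
      · subst h
        exact ⟨.nil, rfl⟩
      · obtain ⟨w, -, hw⟩ := hdesc u h
        omega
    | succ n ih =>
      intro u hu
      obtain ⟨w, hwu, hw⟩ := hdesc u (by rintro rfl; omega)
      obtain ⟨p, hp⟩ := ih w (by omega)
      exact ⟨p.concat hwu, by simp [hp]⟩
  have hle : ∀ {x y : V} (p : G.Walk x y), f y ≤ f x + p.length := by
    intro x y p
    induction p with
    | nil => simp
    | cons h p ih =>
      have := hlip _ _ h
      rw [Walk.length_cons]
      omega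
  obtain ⟨p, hp⟩ := hwalk _ u rfl
  obtain ⟨q, hq⟩ := p.reachable.exists_walk_length_eq_dist
  have h₁ := dist_le p
  have h₂ := hle q
  omega

end SimpleGraph

section Starlike

variable {t : ℕ} {k : Fin t → ℕ}

theorem starlike_adj_none_some (i : Fin t) (j : Fin (k i)) :
    (starlike t k).Adj none (some ⟨i, j⟩) ↔ (j : ℕ) = 0 := by
  simp only [starlike, SimpleGraph.fromRel_adj]
  constructor
  · rintro ⟨-, (⟨i', j', -, h, h0⟩ | ⟨i', j', j'', h, -⟩) |
      (⟨i', j', h, -⟩ | ⟨i', j', j'', -, h, -⟩)⟩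
    · cases h
      exact h0
    all_goals cases h
  · intro h
    exact ⟨by simp, .inl (.inl ⟨i, j, trivial, rfl, h⟩)⟩

theorem starlike_adj_some_some (x y : Σ i : Fin t, Fin (k i)) :
    (starlike t k).Adj (some x) (some y) ↔
      x.1 = y.1 ∧ ((y.2 : ℕ) = x.2 + 1 ∨ (x.2 : ℕ) = y.2 + 1) := by
  simp only [starlike, SimpleGraph.fromRel_adj]
  constructor
  · rintro ⟨-, (⟨i', j', h, -⟩ | ⟨i', j', j'', h, h', h0⟩) |
      (⟨i', j', h, -⟩ | ⟨i', j', j'', h, h', h0⟩)⟩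
    · cases h
    · cases h
      cases h'
      exact ⟨rfl, .inl h0⟩
    · cases h
    · cases h
      cases h'
      exact ⟨rfl, .inr h0⟩
  · obtain ⟨i, j⟩ := x
    obtain ⟨i', j'⟩ := y
    rintro ⟨h, h'⟩
    dsimp only at h h'
    subst h
    refine ⟨?_, ?_⟩
    · intro h
      cases h
      omega
    · rcases h' with h' | h'
      · exact .inl (.inr ⟨i, j, j', rfl, rfl, h'⟩)
      · exact .inr (.inr ⟨i, j', j, rfl, rfl, h'⟩)

/-- The distance of two vertices of a starlike tree, in coordinates. -/
def starlikeDist : Option (Σ i : Fin t, Fin (k i)) → Option (Σ i : Fin t, Fin (k i)) → ℕ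
  | none, none => 0
  | none, some y => y.2 + 1
  | some x, none => x.2 + 1
  | some x, some y =>
    if x.1 = y.1 then ((x.2 : ℕ) - y.2) + ((y.2 : ℕ) - x.2) else x.2 + y.2 + 2

theorem starlike_dist (v u : Option (Σ i : Fin t, Fin (k i))) :
    (starlike t k).dist v u = starlikeDist v u := by
  refine SimpleGraph.dist_eq_of_lipschitz_of_descent v (starlikeDist v) ?_ ?_ ?_ u
  · cases v <;> simp [starlikeDist]
  · rintro (_ | x) (_ | y) h
    · exact absurd h ((starlike t k).irrefl)
    · have := (starlike_adj_none_some _ _).1 h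
      rcases v with _ | v <;> simp only [starlikeDist]
      · omega
      · split_ifs <;> omega
    · have := (starlike_adj_none_some _ _).1 h.symm
      rcases v with _ | v <;> simp only [starlikeDist]
      · omega
      · split_ifs <;> omega
    · obtain ⟨h₁, h₂⟩ := (starlike_adj_some_some _ _).1 h
      rcases v with _ | v <;> simp only [starlikeDist]
      · omega
      · have h₃ : v.1 = x.1 ↔ v.1 = y.1 := by rw [h₁]
        simp only [h₃]
        split_ifs <;> omega
  · rintro (_ | ⟨i, j⟩) hne
    · rcases v with _ | ⟨i, j⟩
      · exact absurd rfl hne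
      · refine ⟨some ⟨i, ⟨0, j.pos⟩⟩, ((starlike_adj_none_some _ _).2 rfl).symm, ?_⟩
        simp [starlikeDist]
    · by_cases hup : ∃ j' : Fin (k i), v = some ⟨i, j'⟩ ∧ j < j'
      · obtain ⟨j', rfl, hj⟩ := hup
        have hj : (j : ℕ) < j' := hj
        refine ⟨some ⟨i, ⟨j + 1, by omega⟩⟩, (starlike_adj_some_some _ _).2 ⟨rfl, .inr rfl⟩, ?_⟩
        simp only [starlikeDist, if_true]
        omega
      · rcases Nat.eq_zero_or_pos (j : ℕ) with h0 | h0
        · refine ⟨none, (starlike_adj_none_some _ _).2 h0, ?_⟩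
          rcases v with _ | ⟨i', j'⟩ <;> simp only [starlikeDist]
          · omega
          · split_ifs with h
            · subst h
              have h₁ : ¬ j < j' := fun h => hup ⟨j', rfl, h⟩
              have h₂ : j ≠ j' := fun h => hne (by rw [h])
              omega
            · omega
        · refine ⟨some ⟨i, ⟨j - 1, by omega⟩⟩,
            (starlike_adj_some_some _ _).2 ⟨rfl, .inl (by dsimp only; omega)⟩, ?_⟩
          rcases v with _ | ⟨i', j'⟩ <;> simp only [starlikeDist]
          · omega
          · split_ifs with h
            · subst h
              have h₁ : ¬ j < j' := fun h => hup ⟨j', rfl, h⟩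
              have h₂ : j ≠ j' := fun h => hne (by rw [h])
              omega
            · omega

theorem sum_range_min_add_one (j r : ℕ) :
    ∑ x ∈ Finset.range (j + 1 + r), 2 * (min j x + 1) = (j + 1) * (j + 2 + 2 * r) := by
  induction r with
  | zero =>
    have h : ∀ n ≤ j + 1, ∑ x ∈ Finset.range n, 2 * (min j x + 1) = n * (n + 1) := by
      intro n
      induction n with
      | zero => simp
      | succ n ih =>
        intro hn
        rw [Finset.sum_range_succ, ih (by omega), min_eq_right (by omega)]
        ring
    rw [add_zero, h _ le_rfl]
  | succ r ih =>
    rw [← add_assoc, Finset.sum_range_succ, ih, min_eq_left (by omega)]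
    ring

theorem transmission_starlike_some (i : Fin t) (j : Fin (k i)) :
    (transmission (starlike t k) (some ⟨i, j⟩) : ℤ) =
      transmission (starlike t k) none +
        ((j : ℤ) + 1) * ((∑ i, (k i : ℤ)) - 2 * k i + (j + 1)) := by
  have harm : ∀ i' : Fin t, ∑ j' : Fin (k i'),
      (starlikeDist (some ⟨i, j⟩) (some ⟨i', j'⟩) : ℤ) =
        (∑ j' : Fin (k i'), (starlikeDist none (some ⟨i', j'⟩) : ℤ)) + (j + 1) * k i' -
          if i' = i then ((j : ℤ) + 1) * (2 * k i - j) else 0 := by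
    intro i'
    split_ifs with h
    · subst h
      obtain ⟨r, hr⟩ := Nat.exists_eq_add_of_le (Nat.succ_le_of_lt j.2)
      have hs := sum_range_min_add_one j r
      rw [← Nat.succ_eq_add_one, ← hr, ← Fin.sum_univ_eq_sum_range] at hs
      have hs' : ∑ x : Fin (k i'), (2 * (min (j : ℕ) x + 1) : ℤ) = (j + 1) * (2 * k i' - j) := by
        have hr' : (k i' : ℤ) = j + 1 + r := by omega
        have := congrArg (Nat.cast : ℕ → ℤ) hs
        push_cast at this
        rw [hr']
        push_cast
        rw [this]
        ring
      have hc : ((j : ℤ) + 1) * k i' = ∑ _x : Fin (k i'), ((j : ℤ) + 1) := by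
        simp [mul_comm]
      rw [← hs', hc, ← Finset.sum_add_distrib, ← Finset.sum_sub_distrib]
      refine Finset.sum_congr rfl fun x _ => ?_
      simp only [starlikeDist, if_true]
      omega
    · have hc : ((j : ℤ) + 1) * k i' = ∑ _x : Fin (k i'), ((j : ℤ) + 1) := by
        simp [mul_comm]
      rw [hc, ← Finset.sum_add_distrib, sub_zero]
      refine Finset.sum_congr rfl fun x _ => ?_
      simp only [starlikeDist, if_neg (Ne.symm h)]
      push_cast
      ring
  simp only [transmission, starlike_dist, Fintype.sum_option, Fintype.sum_sigma]
  push_cast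
  simp only [harm, Finset.sum_sub_distrib, Finset.sum_add_distrib, ← Finset.mul_sum,
    Finset.sum_ite_eq', Finset.mem_univ, if_true]
  simp only [starlikeDist]
  push_cast
  ring

end Starlike

theorem two_mul_sum_consecutive (a k : ℕ) :
    2 * ∑ i : Fin (k + 1), ((a + i.val : ℕ) : ℤ) = (k + 1) * (2 * a + k) := by
  rw [Fin.sum_univ_eq_sum_range (fun i => ((a + i : ℕ) : ℤ)) (k + 1)]
  induction k with
  | zero => simp
  | succ k ih =>
    rw [Finset.sum_range_succ, mul_add, ih]
    push_cast
    ring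

/-- The vertex at depth `i + 2 * e` of an arm of length at most `a + k` has a larger transmission
than the vertex at depth `i` of an arm of length `q ≥ a`. -/
theorem transmission_excess_lt {a k m i e p q : ℤ} (ha : 1 ≤ a) (hk : 2 ≤ k)
    (hm : 2 * m = (k + 1) * (2 * a + k)) (hi : 1 ≤ i) (he : 1 ≤ e)
    (hp : p ≤ a + k) (hq : a ≤ q) (hiq : i ≤ q) :
    i * (m - 2 * q + i) < (i + 2 * e) * (m - 2 * p + (i + 2 * e)) := by
  have hp' : (i + 2 * e) * p ≤ (i + 2 * e) * (a + k) :=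
    mul_le_mul_of_nonneg_left hp (by omega)
  have key : i * (a + k) - i * q < m + 2 * i + 2 - 2 * (a + k) := by
    rcases le_total i a with hia | hia
    · have h₁ : i * a ≤ i * q := mul_le_mul_of_nonneg_left hq (by omega)
      have h₂ : 0 ≤ (a - i) * (k - 2) := mul_nonneg (by omega) (by omega)
      nlinarith [mul_nonneg (sub_nonneg.2 hk) (sub_nonneg.2 hk)]
    · obtain ⟨s, rfl⟩ : ∃ s, i = a + s := ⟨i - a, by ring⟩
      have h₁ : (a + s) * (a + s) ≤ (a + s) * q := mul_le_mul_of_nonneg_left hiq (by omega)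
      have hs : 0 ≤ s := by omega
      nlinarith [mul_nonneg (by omega : (0 : ℤ) ≤ a) hs, sq_nonneg (2 * (k - s) - 3), sq_nonneg s]
  have hpos : 0 < m + 2 * i + 2 - 2 * (a + k) := by
    nlinarith [mul_nonneg (sub_nonneg.2 ha) (sub_nonneg.2 hk), sq_nonneg (k - 2)]
  have h₃ : 0 ≤ (e - 1) * (m + 2 * i + 2 - 2 * (a + k)) := mul_nonneg (by omega) hpos.le
  have h₄ : 0 ≤ e * (e - 1) := mul_nonneg (by omega) (by omega)
  nlinarith

theorem transmission_excess_pos {a k m i p : ℤ} (ha : 1 ≤ a) (hk : 2 ≤ k)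
    (hm : 2 * m = (k + 1) * (2 * a + k)) (hi : 1 ≤ i) (hp : p ≤ a + k) :
    0 < i * (m - 2 * p + i) := by
  refine mul_pos (by omega) ?_
  nlinarith [mul_nonneg (sub_nonneg.2 ha) (sub_nonneg.2 hk), sq_nonneg (2 * k - 5)]

theorem even_of_mod_four {a k : ℕ} {m : ℤ} (hm : 2 * m = (k + 1) * (2 * a + k))
    (hcong : k % 4 = 3 ∨ (k + 2 * a) % 4 = 0) : Even m := by
  rcases hcong with h | h
  · obtain ⟨s, hs⟩ : ∃ s : ℤ, (k : ℤ) + 1 = 4 * s := ⟨(k + 1) / 4, by omega⟩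
    rw [hs] at hm
    exact ⟨s * (2 * a + k), by linarith⟩
  · obtain ⟨s, hs⟩ : ∃ s : ℤ, 2 * (a : ℤ) + k = 4 * s := ⟨(2 * a + k) / 4, by omega⟩
    rw [hs] at hm
    exact ⟨(k + 1) * s, by linarith⟩

/-- Vertices at distinct depths `i < j` have distinct transmissions. -/
theorem transmission_excess_ne {a k m i j p q : ℤ} (ha : 1 ≤ a) (hk : 2 ≤ k)
    (hm : 2 * m = (k + 1) * (2 * a + k)) (hme : Even m) (hi : 1 ≤ i) (hij : i < j)
    (hp : p ≤ a + k) (hq : a ≤ q) (hiq : i ≤ q) :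
    i * (m - 2 * q + i) ≠ j * (m - 2 * p + j) := by
  intro h
  have hpar : Even i ↔ Even j := by
    have := congrArg Even h
    simpa [Int.even_mul, Int.even_add, Int.even_sub, hme] using this
  obtain ⟨e, he⟩ : Even (j - i) := Int.even_sub.2 hpar.symm
  obtain rfl : j = i + 2 * e := by omega
  exact (transmission_excess_lt ha hk hm hi (by omega) hp hq hiq).ne h

/-- `T(a, a+1, …, a+k)` is transmission irregular whenever `k ≡ 3 (mod 4)` or
`k + 2a ≡ 0 (mod 4)`. -/
theorem stmt_7 (a k : ℕ) (ha : 1 ≤ a) (hk : 2 ≤ k)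
    (hcong : k % 4 = 3 ∨ (k + 2 * a) % 4 = 0) :
    TransmissionIrregular (starlike (k + 1) (fun i => a + i.val)) := by
  have hm := two_mul_sum_consecutive a k
  have hme := even_of_mod_four hm hcong
  have ha' : (1 : ℤ) ≤ a := by exact_mod_cast ha
  have hk' : (2 : ℤ) ≤ k := by exact_mod_cast hk
  have hpos : ∀ x, transmission (starlike (k + 1) (fun i => a + i.val)) (some x) ≠
      transmission (starlike (k + 1) (fun i => a + i.val)) none := by
    rintro ⟨i, j⟩ h
    have h₁ := transmission_starlike_some (k := fun i : Fin (k + 1) => a + i.val) i j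
    have h₂ := transmission_excess_pos (i := (j : ℤ) + 1) (p := ((a + i.val : ℕ) : ℤ))
      ha' hk' hm (by omega) (by omega)
    rw [h] at h₁
    linarith
  rintro (_ | ⟨i, j⟩) (_ | ⟨i', j'⟩) h
  · rfl
  · exact absurd h.symm (hpos _)
  · exact absurd h (hpos _)
  · have h₁ := transmission_starlike_some (k := fun i : Fin (k + 1) => a + i.val) i j
    have h₂ := transmission_starlike_some (k := fun i : Fin (k + 1) => a + i.val) i' j'
    rw [h, h₂, add_right_inj] at h₁
    have hj := j.2
    have hj' := j'.2
    rcases lt_trichotomy (j : ℕ) j' with hlt | heq | hlt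
    · exact absurd h₁.symm (transmission_excess_ne ha' hk' hm hme (by omega) (by omega)
        (by omega) (by omega) (by omega))
    · rw [heq] at h₁
      have h₃ := mul_left_cancel₀ (by omega) h₁
      obtain rfl : i = i' := by
        ext
        push_cast at h₃
        linarith
      obtain rfl : j = j' := Fin.ext heq
      rfl
    · exact absurd h₁ (transmission_excess_ne ha' hk' hm hme (by omega) (by omega)
        (by omega) (by omega) (by omega))
end

section
/- Let l >= 3 be an integer and let T = T(1, 2, ..., l) be the starlike tree with arms of lengths 1, 2, ..., l. Then T is transmission irregular if and only if l is not of the form r^2 + 1 for some integer r >= 2. -/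
/-- A function which vanishes only at `v`, is `1`-Lipschitz along edges, and can always be decreased
by one along some edge is the distance from `v`. -/
theorem SimpleGraph.dist_eq_of_descent {V : Type*} (G : SimpleGraph V) (v : V) (D : V → ℕ)
    (hv : D v = 0) (hlip : ∀ x y, G.Adj x y → D y ≤ D x + 1)
    (hdesc : ∀ x, x ≠ v → ∃ y, G.Adj y x ∧ D x = D y + 1) (x : V) : G.dist v x = D x := by
  have hwalk : ∀ n x, D x = n → ∃ p : G.Walk v x, p.length = n := by
    intro n
    induction n with
    | zero =>
      intro x hx
      by_cases h : x = v
      · subst h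
        exact ⟨.nil, rfl⟩
      · obtain ⟨y, -, hy⟩ := hdesc x h
        omega
    | succ n ih =>
      intro x hx
      obtain ⟨y, hyx, hy⟩ := hdesc x (by rintro rfl; omega)
      obtain ⟨p, hp⟩ := ih y (by omega)
      exact ⟨p.concat hyx, by simp [hp]⟩
  have hle : ∀ {a b : V} (p : G.Walk a b), D b ≤ D a + p.length := by
    intro a b p
    induction p with
    | nil => simp
    | cons h p ih =>
      have := hlip _ _ h
      rw [SimpleGraph.Walk.length_cons]
      omega
  obtain ⟨p, hp⟩ := hwalk _ x rfl
  obtain ⟨q, hq⟩ := p.reachable.exists_walk_length_eq_dist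
  have := hle q
  have := G.dist_le p
  omega

section Starlike

variable {t : ℕ} {k : Fin t → ℕ}

theorem starlike_adj_succ (i : Fin t) (j j' : Fin (k i)) (h : (j' : ℕ) = j + 1) :
    (starlike t k).Adj (some ⟨i, j⟩) (some ⟨i, j'⟩) := by
  refine ⟨fun he => ?_, .inl (.inr ⟨i, j, j', rfl, rfl, h⟩)⟩
  cases he
  omega

/-- The edges of a starlike tree join the centre to the first vertex of an arm, or two consecutive
vertices of an arm. -/
theorem starlike_adj_induction {P : Option (Σ i : Fin t, Fin (k i)) → _ → Prop}
    (symm : ∀ x y, P x y → P y x)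
    (centre : ∀ i (j : Fin (k i)), (j : ℕ) = 0 → P none (some ⟨i, j⟩))
    (arm : ∀ i (j j' : Fin (k i)), (j' : ℕ) = j + 1 → P (some ⟨i, j⟩) (some ⟨i, j'⟩))
    {x y : Option (Σ i : Fin t, Fin (k i))} (h : (starlike t k).Adj x y) : P x y := by
  obtain ⟨-, (⟨i, j, rfl, rfl, h⟩ | ⟨i, j, j', rfl, rfl, h⟩) |
    (⟨i, j, rfl, rfl, h⟩ | ⟨i, j, j', rfl, rfl, h⟩)⟩ := h
  · exact centre i j h
  · exact arm i j j' h
  · exact symm _ _ (centre i j h)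
  · exact symm _ _ (arm i j j' h)

/-- The distance from the centre of a starlike tree. -/
def starlikeDepth : Option (Σ i : Fin t, Fin (k i)) → ℕ
  | none => 0
  | some ⟨_, j⟩ => j + 1

/-- The distance from the vertex `some ⟨i, j⟩` of a starlike tree. -/
def starlikeDistFrom (i : Fin t) (j : Fin (k i)) : Option (Σ i : Fin t, Fin (k i)) → ℕ
  | none => j + 1
  | some ⟨i', j'⟩ => if i = i' then ((j : ℕ) - j') + (j' - j) else j + j' + 2

theorem starlike_dist_none (x : Option (Σ i : Fin t, Fin (k i))) :
    (starlike t k).dist none x = starlikeDepth x := by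
  refine SimpleGraph.dist_eq_of_descent _ _ starlikeDepth rfl (fun x y h => ?_) ?_ x
  · refine (starlike_adj_induction (P := fun x y => starlikeDepth y ≤ starlikeDepth x + 1 ∧
      starlikeDepth x ≤ starlikeDepth y + 1) (fun _ _ h => h.symm) ?_ ?_ h).1
    · intro i j h
      simp [starlikeDepth, h]
    · intro i j j' h
      simp only [starlikeDepth]
      omega
  · rintro (_ | ⟨i, j⟩) hx
    · exact absurd rfl hx
    · obtain ⟨_ | j, hj⟩ := j
      · exact ⟨none, (starlike_adj_none_some _ _).2 rfl, rfl⟩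
      · exact ⟨some ⟨i, j, by omega⟩, starlike_adj_succ _ _ _ rfl, rfl⟩

theorem starlike_dist_some (i : Fin t) (j : Fin (k i)) (x : Option (Σ i : Fin t, Fin (k i))) :
    (starlike t k).dist (some ⟨i, j⟩) x = starlikeDistFrom i j x := by
  refine SimpleGraph.dist_eq_of_descent _ _ _ (by simp [starlikeDistFrom]) (fun x y h => ?_) ?_ x
  · refine (starlike_adj_induction
      (P := fun x y => starlikeDistFrom i j y ≤ starlikeDistFrom i j x + 1 ∧
        starlikeDistFrom i j x ≤ starlikeDistFrom i j y + 1) (fun _ _ h => h.symm) ?_ ?_ h).1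
    · intro i' j' h
      simp only [starlikeDistFrom]
      split_ifs <;> omega
    · intro i' j' j'' h
      simp only [starlikeDistFrom]
      split_ifs <;> omega
  · rintro (_ | ⟨i', j'⟩) hx
    · refine ⟨some ⟨i, 0, j.pos⟩, ((starlike_adj_none_some _ _).2 rfl).symm, ?_⟩
      simp [starlikeDistFrom]
    · by_cases hi : i = i'
      · subst hi
        have hne : (j' : ℕ) ≠ j := fun h => hx (by rw [Fin.ext h])
        obtain hlt | hlt := lt_or_gt_of_ne hne
        · refine ⟨some ⟨i, j' + 1, by omega⟩, (starlike_adj_succ _ _ _ rfl).symm, ?_⟩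
          simp only [starlikeDistFrom, if_true]
          omega
        · refine ⟨some ⟨i, j' - 1, by omega⟩, starlike_adj_succ _ _ _ ?_, ?_⟩
          · simp only
            omega
          · simp only [starlikeDistFrom, if_true]
            omega
      · obtain ⟨_ | j', hj'⟩ := j'
        · refine ⟨none, (starlike_adj_none_some _ _).2 rfl, ?_⟩
          simp [starlikeDistFrom, hi]
        · refine ⟨some ⟨i', j', by omega⟩, starlike_adj_succ _ _ _ rfl, ?_⟩
          simp only [starlikeDistFrom, if_neg hi]
          omega

theorem sum_range_two_mul_min (d m : ℕ) :
    ∑ x ∈ Finset.range (d + m), 2 * min d (x + 1) = d * (d + 1) + 2 * d * m := by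
  induction m with
  | zero =>
    have h := Finset.sum_range_id_mul_two (d + 1)
    rw [Finset.sum_range_succ', add_zero, Finset.sum_mul, Nat.add_sub_cancel] at h
    rw [add_zero, mul_zero, add_zero, mul_comm d, ← h]
    refine Finset.sum_congr rfl fun x hx => ?_
    have := Finset.mem_range.1 hx
    rw [min_eq_right (by omega), mul_comm]
  | succ m ih =>
    rw [← add_assoc, Finset.sum_range_succ, ih, min_eq_left (by omega)]
    ring

theorem starlike_transmission_some (i : Fin t) (j : Fin (k i)) :
    transmission (starlike t k) (some ⟨i, j⟩) + 2 * k i * (j + 1) =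
      transmission (starlike t k) none + (j + 1) * (∑ i, k i + (j + 1)) := by
  have hpt : ∀ (i' : Fin t) (j' : Fin (k i')), starlikeDistFrom i j (some ⟨i', j'⟩) +
      (if i = i' then 2 * min ((j : ℕ) + 1) (j' + 1) else 0) =
      starlikeDepth (some ⟨i', j'⟩) + (j + 1) := by
    intro i' j'
    simp only [starlikeDistFrom, starlikeDepth]
    split_ifs <;> omega
  have hsum := Finset.sum_congr (rfl : (Finset.univ : Finset (Fin t)) = Finset.univ)
    fun i' _ => Finset.sum_congr (rfl : (Finset.univ : Finset (Fin (k i'))) = Finset.univ)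
    fun j' _ => hpt i' j'
  have hown : ∑ i', ∑ j' : Fin (k i'), (if i = i' then 2 * min ((j : ℕ) + 1) (j' + 1) else 0) =
      ∑ j' : Fin (k i), 2 * min ((j : ℕ) + 1) (j' + 1) := by
    rw [Finset.sum_eq_single i]
    · simp
    · intro i' _ hi'
      simp [Ne.symm hi']
    · simp
  obtain ⟨m, hm⟩ := Nat.exists_eq_add_of_le (Nat.succ_le_of_lt j.isLt)
  have hmin : ∑ j' : Fin (k i), 2 * min ((j : ℕ) + 1) (j' + 1) =
      (j + 1) * (j + 1 + 1) + 2 * (j + 1) * m := by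
    rw [Fin.sum_univ_eq_sum_range (fun x => 2 * min ((j : ℕ) + 1) (x + 1)),
      ← sum_range_two_mul_min]
    exact congrArg (fun n => ∑ x ∈ Finset.range n, 2 * min ((j : ℕ) + 1) (x + 1)) hm
  simp only [Finset.sum_add_distrib, hown, hmin, Finset.sum_const, Finset.card_univ,
    Fintype.card_fin, smul_eq_mul, ← Finset.sum_mul] at hsum
  simp only [transmission, Fintype.sum_option, Fintype.sum_sigma, starlike_dist_none,
    starlike_dist_some]
  have h1 : starlikeDepth (none : Option (Σ i : Fin t, Fin (k i))) = 0 := rfl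
  have h2 : starlikeDistFrom i j none = j + 1 := rfl
  rw [h1, h2]
  have hm' : k i = j + 1 + m := hm
  linear_combination hsum + 2 * ((j : ℕ) + 1) * hm'

end Starlike

/-- Two vertices at depths `d < e`, on arms of lengths `a` and `b` of `T(1, …, l)`, can only have
the same transmission if `l - 1` is a perfect square. -/
theorem isSquare_of_transmission_eq {l d e a b M : ℤ} (hl : 3 ≤ l) (hM : 2 * M = l * (l + 1))
    (hd : 0 < d) (hde : d < e) (hda : d ≤ a) (hbl : b ≤ l)
    (h : d * (M - 2 * a + d) = e * (M - 2 * b + e)) :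
    l - 1 = (2 * d - (l - 1)) ^ 2 := by
  obtain ⟨u, rfl⟩ : ∃ u, a = d + u := ⟨a - d, by ring⟩
  obtain ⟨w, rfl⟩ : ∃ w, b = l - w := ⟨l - b, by ring⟩
  have hu : 0 ≤ u := by linarith
  have hw : 0 ≤ w := by linarith
  obtain he | he : e = d + 1 ∨ d + 2 ≤ e := by omega
  · subst he
    have key : (2 * d - (l - 1)) ^ 2 - (l - 1) + 4 * w * (d + 1) + 4 * u * d = 0 := by
      linear_combination (-2) * h - hM
    obtain hz | hz : (u = 0 ∧ w = 0) ∨ 1 ≤ u + w := by omega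
    · obtain ⟨rfl, rfl⟩ := hz
      linarith
    · nlinarith [sq_nonneg (2 * d - (l - 1) + 1), mul_le_mul_of_nonneg_right hz hd.le]
  · obtain ⟨s, rfl⟩ : ∃ s, e = d + 2 + s := ⟨e - d - 2, by ring⟩
    have hs : 0 ≤ s := by linarith
    have key : (2 * d - (l - 2)) ^ 2 + (l - 1) ^ 2 + 3 + s * (l * (l - 3)) + 4 * d * s +
        8 * s + 2 * s ^ 2 + 4 * w * (d + 2 + s) + 4 * u * d = 0 := by
      linear_combination (-2) * h - (2 + s) * hM
    have : 0 ≤ s * (l * (l - 3)) := mul_nonneg hs (mul_nonneg (by linarith) (by linarith))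
    have : 0 ≤ w * (d + 2 + s) := mul_nonneg hw (by linarith)
    have : 0 ≤ u * d := mul_nonneg hu hd.le
    have : 0 ≤ d * s := mul_nonneg hd.le hs
    nlinarith [sq_nonneg (2 * d - (l - 2)), sq_nonneg (l - 1), sq_nonneg s]

/-- `T(1, 2, …, ℓ)` (`ℓ ≥ 3`) is transmission irregular if and only if `ℓ` is not of
the form `r² + 1` for some integer `r ≥ 2`. -/
theorem stmt_9 (l : ℕ) (hl : 3 ≤ l) :
    TransmissionIrregular (starlike l (fun i => i.val + 1)) ↔
      ¬ ∃ r : ℕ, 2 ≤ r ∧ l = r ^ 2 + 1 := by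
  obtain ⟨M, hM⟩ : ∃ M : ℤ, M = ((∑ i : Fin l, (i.val + 1) : ℕ) : ℤ) := ⟨_, rfl⟩
  have hM2 : 2 * M = (l : ℤ) * (l + 1) := by
    have h := Finset.sum_range_id_mul_two (l + 1)
    rw [Finset.sum_range_succ', add_zero, ← Fin.sum_univ_eq_sum_range (fun x => x + 1)] at h
    rw [hM, mul_comm]
    have h' : (∑ i : Fin l, (i.val + 1)) * 2 = l * (l + 1) := by
      rw [h, Nat.add_sub_cancel, mul_comm]
    exact_mod_cast h'
  have htr : ∀ (i : Fin l) (j : Fin (i.val + 1)),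
      (transmission (starlike l fun i => i.val + 1) (some ⟨i, j⟩) : ℤ) =
        transmission (starlike l fun i => i.val + 1) none +
          ((j : ℤ) + 1) * (M - 2 * ((i : ℤ) + 1) + (j + 1)) := by
    intro i j
    have h := starlike_transmission_some (k := fun i : Fin l => i.val + 1) i j
    zify at h
    rw [hM]
    push_cast at h ⊢
    linear_combination h
  have hl' : (3 : ℤ) ≤ l := by exact_mod_cast hl
  constructor
  · rintro hinj ⟨r, hr, rfl⟩
    obtain ⟨s, rfl⟩ : ∃ s, r = s + 2 := ⟨r - 2, by omega⟩
    obtain ⟨d, hd⟩ : ∃ d, (s + 1) * (s + 2) = d + d := Nat.even_mul_succ_self (s + 1)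
    have hd0 : 1 ≤ d := by nlinarith
    have hdl : d + 1 ≤ (s + 2) ^ 2 := by nlinarith
    obtain ⟨c, rfl⟩ : ∃ c, d = c + 1 := ⟨d - 1, by omega⟩
    have heq : (some ⟨⟨c, by omega⟩, ⟨c, by simp⟩⟩ :
        Option (Σ i : Fin ((s + 2) ^ 2 + 1), Fin (i.val + 1))) =
        some ⟨⟨(s + 2) ^ 2, by omega⟩, ⟨c + 1, by simp only; omega⟩⟩ := by
      apply hinj
      zify
      rw [htr, htr]
      zify at hd
      push_cast at hM2 ⊢
      have hc : (c : ℤ) * 2 = (s + 1) * (s + 2) - 2 := by linarith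
      have : (c : ℤ) * 2 * (c * 2) = ((s + 1) * (s + 2) - 2) * ((s + 1) * (s + 2) - 2) := by
        rw [hc]
      nlinarith
    simp only [Option.some.injEq, Sigma.mk.injEq, Fin.mk.injEq] at heq
    omega
  · intro hsq
    have hpos : ∀ (i : Fin l) (j : Fin (i.val + 1)),
        0 < ((j : ℤ) + 1) * (M - 2 * ((i : ℤ) + 1) + (j + 1)) := by
      intro i j
      have : (i : ℤ) + 1 ≤ l := by have := i.isLt; omega
      exact mul_pos (by positivity) (by nlinarith)
    have hlt : ∀ (i : Fin l) (j : Fin (i.val + 1)) (i' : Fin l) (j' : Fin (i'.val + 1)),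
        (j : ℕ) < j' → ((j : ℤ) + 1) * (M - 2 * ((i : ℤ) + 1) + (j + 1)) ≠
          ((j' : ℤ) + 1) * (M - 2 * ((i' : ℤ) + 1) + (j' + 1)) := by
      intro i j i' j' hjj h
      have hs := isSquare_of_transmission_eq hl' hM2 (by positivity) (by omega) (by omega)
        (by omega) h
      refine hsq ⟨(2 * ((j : ℤ) + 1) - (l - 1)).natAbs, ?_, ?_⟩
      · by_contra hlt2
        have : |2 * ((j : ℤ) + 1) - (l - 1)| ≤ 1 := by
          rw [Int.abs_eq_natAbs]
          exact_mod_cast Nat.lt_succ_iff.1 (not_le.1 hlt2)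
        have := (sq_le_one_iff_abs_le_one _).2 this
        linarith
      · zify
        rw [sq_abs]
        linarith
    rintro (_ | ⟨i, j⟩) (_ | ⟨i', j'⟩) h
    · rfl
    · zify at h
      rw [htr] at h
      linarith [hpos i' j']
    · zify at h
      rw [htr] at h
      linarith [hpos i j]
    · zify at h
      rw [htr, htr, add_right_inj] at h
      obtain hjj | hjj | hjj := lt_trichotomy (j : ℕ) j'
      · exact absurd h (hlt _ _ _ _ hjj)
      · rw [hjj] at h
        have h' := mul_left_cancel₀ (by positivity) h
        obtain rfl : i = i' := Fin.ext (by omega)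
        rw [Fin.ext hjj]
      · exact absurd h.symm (hlt _ _ _ _ hjj)
end
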